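/- arXiv:2111.05775 — 5 statements merged into one kernel-verified Lean document; each statement's English description precedes it below -/
import Mathlib

section
/- Let X ∈ ℝ^{m×s}, Y ∈ ℝ^{n×s}, Z ∈ ℝ^{q×s} with Z Yᵀ = 0. Let R_Y be the positive semidefinite square root of Y Yᵀ and let P_Y satisfy the four Penrose conditions with respect to R_Y; similarly let R_Z be the positive semidefinite square root of Z Zᵀ and let P_Z satisfy the four Penrose conditions with respect to R_Z. Put S_Y = X Yᵀ P_Y and S_Z = X Zᵀ P_Z. Let M_Y be a matrix of rank at most k₁ minimizing ‖S_Y − M‖_F over all matrices M of rank at most k₁, and let M_Z be a matrix of rank at most k₂ minimizing ‖S_Z − M‖_F over all matrices M of rank at most k₂. Then F₁ := M_Y P_Y has rank at most k₁, F₂ := M_Z P_Z has rank at most k₂, and for every F₁' ∈ ℝ^{m×n} of rank at most k₁ and every F₂' ∈ ℝ^{m×q} of rank at most k₂, ‖X − F₁ Y − F₂ Z‖_F ≤ ‖X − F₁' Y − F₂' Z‖_F. (This is Theorem 1 of the paper: the optimal rank-constrained two-term compressor/decompressor.) -/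
open Matrix

/-- The Frobenius norm of a real matrix. -/
noncomputable def frob {m n : Type*} [Fintype m] [Fintype n] (A : Matrix m n ℝ) : ℝ :=
  Real.sqrt (∑ i, ∑ j, (A i j) ^ 2)

/-- `P` satisfies the four Penrose conditions with respect to `A`
(i.e. `P` is the Moore–Penrose pseudoinverse of `A`). -/
def IsPenrose {m n : Type*} [Fintype m] [Fintype n]
    (A : Matrix m n ℝ) (P : Matrix n m ℝ) : Prop :=
  A * P * A = A ∧ P * A * P = P ∧ (A * P)ᵀ = A * P ∧ (P * A)ᵀ = P * A

theorem frob_eq_sqrt_trace {m n : Type*} [Fintype m] [Fintype n] (A : Matrix m n ℝ) :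
    frob A = Real.sqrt (A * Aᵀ).trace := by
  simp [frob, Matrix.trace, Matrix.mul_apply, pow_two]

theorem trace_mul_transpose_nonneg {m n : Type*} [Fintype m] [Fintype n] (A : Matrix m n ℝ) :
    0 ≤ (A * Aᵀ).trace := by
  simp only [Matrix.trace, Matrix.diag_apply, Matrix.mul_apply, Matrix.transpose_apply]
  exact Finset.sum_nonneg fun i _ => Finset.sum_nonneg fun j _ => mul_self_nonneg _

theorem frob_le_frob_iff {m n m' n' : Type*} [Fintype m] [Fintype n] [Fintype m'] [Fintype n']
    (A : Matrix m n ℝ) (B : Matrix m' n' ℝ) :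
    frob A ≤ frob B ↔ (A * Aᵀ).trace ≤ (B * Bᵀ).trace := by
  rw [frob_eq_sqrt_trace, frob_eq_sqrt_trace,
    Real.sqrt_le_sqrt_iff (trace_mul_transpose_nonneg B)]

theorem trace_mul_transpose_comm {m n : Type*} [Fintype m] [Fintype n] (A B : Matrix m n ℝ) :
    (A * Bᵀ).trace = (B * Aᵀ).trace := by
  rw [← Matrix.trace_transpose, Matrix.transpose_mul, Matrix.transpose_transpose]

theorem trace_sub_mul_transpose {m n : Type*} [Fintype m] [Fintype n] (A B : Matrix m n ℝ) :
    ((A - B) * (A - B)ᵀ).trace =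
      (A * Aᵀ).trace - 2 * (A * Bᵀ).trace + (B * Bᵀ).trace := by
  simp only [Matrix.transpose_sub, Matrix.sub_mul, Matrix.mul_sub, Matrix.trace_sub]
  rw [trace_mul_transpose_comm B A]
  ring

/-- Multiplying by an orthogonal projection does not increase the Frobenius norm. -/
theorem frob_mul_le_of_isProj {m n : Type*} [Fintype m] [Fintype n]
    (A : Matrix m n ℝ) (E : Matrix n n ℝ) (hE : Eᵀ = E) (hEE : E * E = E) :
    frob (A * E) ≤ frob A := by
  rw [frob_le_frob_iff]
  have h1 : (A * E) * (A * E)ᵀ = A * (A * E)ᵀ := by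
    rw [Matrix.transpose_mul, hE, Matrix.mul_assoc, ← Matrix.mul_assoc E, hEE]
  have h2 := trace_sub_mul_transpose A (A * E)
  have h3 := trace_mul_transpose_nonneg (A - A * E)
  rw [← h1] at h2
  linarith

/-- A symmetric matrix commutes with its pseudoinverse. -/
theorem IsPenrose.mul_comm_of_symm {n : Type*} [Fintype n] {R P : Matrix n n ℝ}
    (h : IsPenrose R P) (hR : Rᵀ = R) : P * R = R * P := by
  obtain ⟨h1, -, h3, h4⟩ := h
  rw [Matrix.transpose_mul, hR] at h3 h4
  calc P * R = R * P * (P * R) := by rw [← h4, ← Matrix.mul_assoc, h1]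
    _ = R * P := by rw [← h3, Matrix.mul_assoc, ← Matrix.mul_assoc R, h1]

/-- The projection `P * R` fixes the row space of `Yᵀ`. -/
theorem IsPenrose.transpose_mul_mul {n s : Type*} [Fintype n] [Fintype s]
    {R P : Matrix n n ℝ} {Y : Matrix n s ℝ}
    (h : IsPenrose R P) (hR2 : R * R = Y * Yᵀ) : Yᵀ * (P * R) = Yᵀ := by
  have h1 : R * (R * (P * R)) = R * R := by rw [← Matrix.mul_assoc R P, h.1]
  rw [← Matrix.mul_assoc, hR2] at h1
  have h2 : (Yᵀ * (P * R) - Yᵀ)ᵀ * (Yᵀ * (P * R) - Yᵀ) = 0 := by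
    have : Y * (Yᵀ * (P * R) - Yᵀ) = 0 := by
      rw [Matrix.mul_sub, ← Matrix.mul_assoc, h1, sub_self]
    rw [Matrix.transpose_sub, Matrix.transpose_mul, Matrix.transpose_transpose, Matrix.sub_mul,
      Matrix.mul_assoc, this, Matrix.mul_zero, sub_zero]
  rw [← Matrix.conjTranspose_eq_transpose_of_trivial,
    Matrix.conjTranspose_mul_self_eq_zero] at h2
  exact sub_eq_zero.mp h2

/-- Completing the square in the quadratic `F ↦ ‖F Y‖² - 2 ⟪X, F Y⟫`. -/
theorem trace_sub_two_mul_trace_eq {m n s : Type*} [Fintype m] [Fintype n] [Fintype s]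
    (X : Matrix m s ℝ) (Y : Matrix n s ℝ) {R P : Matrix n n ℝ} (hR : Rᵀ = R)
    (hR2 : R * R = Y * Yᵀ) (h : IsPenrose R P) (F : Matrix m n ℝ) :
    (F * Y * (F * Y)ᵀ).trace - 2 * (X * (F * Y)ᵀ).trace =
      ((X * Yᵀ * P - F * R) * (X * Yᵀ * P - F * R)ᵀ).trace -
        (X * Yᵀ * P * (X * Yᵀ * P)ᵀ).trace := by
  have h1 : F * Y * (F * Y)ᵀ = F * R * (F * R)ᵀ := by
    simp only [Matrix.transpose_mul, hR, Matrix.mul_assoc]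
    rw [← Matrix.mul_assoc Y, ← hR2, Matrix.mul_assoc]
  have h2 : X * (F * Y)ᵀ = X * Yᵀ * P * (F * R)ᵀ := by
    simp only [Matrix.transpose_mul, hR, Matrix.mul_assoc]
    conv_lhs => rw [← h.transpose_mul_mul hR2]
    simp only [Matrix.mul_assoc]
  rw [trace_sub_mul_transpose, h1, h2]
  ring

theorem trace_sub_two_mul_trace_le {m n s : Type*} [Fintype m] [Fintype n] [Fintype s]
    (X : Matrix m s ℝ) (Y : Matrix n s ℝ) {R P : Matrix n n ℝ} (hR : Rᵀ = R)
    (hR2 : R * R = Y * Yᵀ) (h : IsPenrose R P) {k : ℕ} (M : Matrix m n ℝ)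
    (hM : ∀ N : Matrix m n ℝ, N.rank ≤ k →
      frob (X * Yᵀ * P - M) ≤ frob (X * Yᵀ * P - N))
    (F : Matrix m n ℝ) (hF : F.rank ≤ k) :
    (M * P * Y * (M * P * Y)ᵀ).trace - 2 * (X * (M * P * Y)ᵀ).trace ≤
      (F * Y * (F * Y)ᵀ).trace - 2 * (X * (F * Y)ᵀ).trace := by
  rw [trace_sub_two_mul_trace_eq X Y hR hR2 h, trace_sub_two_mul_trace_eq X Y hR hR2 h]
  refine sub_le_sub_right ?_ _
  rw [← frob_le_frob_iff]
  have hPPR : P * (P * R) = P := by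
    rw [h.mul_comm_of_symm hR, ← Matrix.mul_assoc, h.2.1]
  have hE : X * Yᵀ * P - M * P * R = (X * Yᵀ * P - M) * (P * R) := by
    rw [Matrix.sub_mul, Matrix.mul_assoc (X * Yᵀ) P, hPPR, Matrix.mul_assoc M]
  rw [hE]
  exact (frob_mul_le_of_isProj _ _ h.2.2.2 (by rw [← Matrix.mul_assoc, h.2.1])).trans
    (hM _ ((Matrix.rank_mul_le_left F R).trans hF))

theorem trace_sub_sub_mul_transpose {m n q s : Type*} [Fintype m] [Fintype n] [Fintype q]
    [Fintype s] (X : Matrix m s ℝ) (Y : Matrix n s ℝ) (Z : Matrix q s ℝ) (hZY : Z * Yᵀ = 0)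
    (F : Matrix m n ℝ) (G : Matrix m q ℝ) :
    ((X - F * Y - G * Z) * (X - F * Y - G * Z)ᵀ).trace =
      (X * Xᵀ).trace + ((F * Y * (F * Y)ᵀ).trace - 2 * (X * (F * Y)ᵀ).trace) +
        ((G * Z * (G * Z)ᵀ).trace - 2 * (X * (G * Z)ᵀ).trace) := by
  have h0 : (F * Y * (G * Z)ᵀ).trace = 0 := by
    rw [trace_mul_transpose_comm, Matrix.transpose_mul, Matrix.mul_assoc, ← Matrix.mul_assoc Z,
      hZY, Matrix.zero_mul, Matrix.mul_zero, Matrix.trace_zero]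
  rw [trace_sub_mul_transpose, trace_sub_mul_transpose, Matrix.sub_mul, Matrix.trace_sub, h0]
  ring

theorem stmt0 {m n s q k₁ k₂ : ℕ}
    (X : Matrix (Fin m) (Fin s) ℝ) (Y : Matrix (Fin n) (Fin s) ℝ)
    (Z : Matrix (Fin q) (Fin s) ℝ) (hZY : Z * Yᵀ = 0)
    (R_Y : Matrix (Fin n) (Fin n) ℝ) (hRY : R_Y.PosSemidef) (hRY2 : R_Y * R_Y = Y * Yᵀ)
    (P_Y : Matrix (Fin n) (Fin n) ℝ) (hPY : IsPenrose R_Y P_Y)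
    (R_Z : Matrix (Fin q) (Fin q) ℝ) (hRZ : R_Z.PosSemidef) (hRZ2 : R_Z * R_Z = Z * Zᵀ)
    (P_Z : Matrix (Fin q) (Fin q) ℝ) (hPZ : IsPenrose R_Z P_Z)
    (M_Y : Matrix (Fin m) (Fin n) ℝ) (hMYrank : M_Y.rank ≤ k₁)
    (hMY : ∀ M : Matrix (Fin m) (Fin n) ℝ, M.rank ≤ k₁ →
      frob (X * Yᵀ * P_Y - M_Y) ≤ frob (X * Yᵀ * P_Y - M))
    (M_Z : Matrix (Fin m) (Fin q) ℝ) (hMZrank : M_Z.rank ≤ k₂)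
    (hMZ : ∀ M : Matrix (Fin m) (Fin q) ℝ, M.rank ≤ k₂ →
      frob (X * Zᵀ * P_Z - M_Z) ≤ frob (X * Zᵀ * P_Z - M)) :
    (M_Y * P_Y).rank ≤ k₁ ∧ (M_Z * P_Z).rank ≤ k₂ ∧
    ∀ (F₁' : Matrix (Fin m) (Fin n) ℝ) (F₂' : Matrix (Fin m) (Fin q) ℝ),
      F₁'.rank ≤ k₁ → F₂'.rank ≤ k₂ →
      frob (X - M_Y * P_Y * Y - M_Z * P_Z * Z) ≤ frob (X - F₁' * Y - F₂' * Z) := by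
  have hRYt : R_Yᵀ = R_Y := by
    rw [← Matrix.conjTranspose_eq_transpose_of_trivial]; exact hRY.isHermitian
  have hRZt : R_Zᵀ = R_Z := by
    rw [← Matrix.conjTranspose_eq_transpose_of_trivial]; exact hRZ.isHermitian
  refine ⟨(Matrix.rank_mul_le_left _ _).trans hMYrank,
    (Matrix.rank_mul_le_left _ _).trans hMZrank, fun F G hF hG => ?_⟩
  rw [frob_le_frob_iff, trace_sub_sub_mul_transpose X Y Z hZY,
    trace_sub_sub_mul_transpose X Y Z hZY]
  have h1 := trace_sub_two_mul_trace_le X Y hRYt hRY2 hPY M_Y hMY F hF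
  have h2 := trace_sub_two_mul_trace_le X Z hRZt hRZ2 hPZ M_Z hMZ G hG
  linarith
end

section
/- Let E₁ and E₂ be topological spaces, K₁ ⊆ E₁ and K₂ ⊆ E₂ nonempty compact sets, and f : E₁ × E₂ → ℝ continuous. Let (F^{(j)}, V^{(j)})_{j≥0} be a sequence in K₁ × K₂ such that for every j: (a) f(F^{(j+1)}, V^{(j+1)}) ≤ f(F, V^{(j)}) for all F ∈ K₁, and (b) f(F^{(j+1)}, V^{(j+1)}) ≤ f(F^{(j)}, V) for all V ∈ K₂. Then every cluster point (F*, V*) ∈ K₁ × K₂ of the sequence (F^{(j)}, V^{(j)}) is a coordinate-wise minimum point of f on K₁ × K₂, i.e., f(F*, V*) ≤ f(F, V*) for all F ∈ K₁ and f(F*, V*) ≤ f(F*, V) for all V ∈ K₂. (This is Theorem 3 of the paper: convergence of Algorithm MTT to a coordinate-wise minimum.) -/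
open Matrix

/-- A continuous function that is nonincreasing along a sequence is bounded below along it by
its value at any cluster point. -/
theorem MapClusterPt.le_of_antitone_comp {X : Type*} [TopologicalSpace X] {f : X → ℝ}
    {S : ℕ → X} {x : X} (hx : MapClusterPt x Filter.atTop S) (hf : Continuous f)
    (hS : Antitone (f ∘ S)) (n : ℕ) : f x ≤ f (S n) := by
  by_contra! h
  obtain ⟨m, hm, hnm⟩ := ((hx.frequently ((isOpen_lt continuous_const hf).mem_nhds h)).and_eventually
    (Filter.eventually_ge_atTop n)).exists
  exact (hS hnm).not_gt hm

/-- If `g` dominates the next value of a continuous function `f` that is nonincreasing along a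
sequence, then `g` dominates `f` at any cluster point. -/
theorem MapClusterPt.le_of_succ_le {X : Type*} [TopologicalSpace X] {f g : X → ℝ}
    {S : ℕ → X} {x : X} (hx : MapClusterPt x Filter.atTop S) (hf : Continuous f)
    (hg : Continuous g) (hS : Antitone (f ∘ S)) (h : ∀ n, f (S (n + 1)) ≤ g (S n)) :
    f x ≤ g x := by
  by_contra! hlt
  obtain ⟨n, hn⟩ := (hx.frequently ((isOpen_lt hg continuous_const).mem_nhds hlt)).exists
  exact ((hx.le_of_antitone_comp hf hS (n + 1)).trans (h n)).not_gt hn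

theorem stmt2 {E₁ E₂ : Type*} [TopologicalSpace E₁] [TopologicalSpace E₂]
    (K₁ : Set E₁) (K₂ : Set E₂) (hK₁ne : K₁.Nonempty) (hK₂ne : K₂.Nonempty)
    (hK₁ : IsCompact K₁) (hK₂ : IsCompact K₂)
    (f : E₁ × E₂ → ℝ) (hf : Continuous f)
    (S : ℕ → E₁ × E₂) (hS : ∀ j, S j ∈ K₁ ×ˢ K₂)
    (ha : ∀ j, ∀ F ∈ K₁, f (S (j + 1)) ≤ f (F, (S j).2))
    (hb : ∀ j, ∀ V ∈ K₂, f (S (j + 1)) ≤ f ((S j).1, V))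
    (Fstar : E₁) (Vstar : E₂) (hmem : (Fstar, Vstar) ∈ K₁ ×ˢ K₂)
    (hcluster : MapClusterPt (Fstar, Vstar) Filter.atTop S) :
    (∀ F ∈ K₁, f (Fstar, Vstar) ≤ f (F, Vstar)) ∧
    (∀ V ∈ K₂, f (Fstar, Vstar) ≤ f (Fstar, V)) := by
  have hanti : Antitone (f ∘ S) := antitone_nat_of_succ_le fun n => ha n _ (hS n).1
  exact ⟨fun F hF => hcluster.le_of_succ_le (g := fun p => f (F, p.2)) hf (by fun_prop) hanti
      fun n => ha n F hF,
    fun V hV => hcluster.le_of_succ_le (g := fun p => f (p.1, V)) hf (by fun_prop) hanti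
      fun n => hb n V hV⟩
end

section
/- Let Y ∈ ℝ^{n×s}, let R be the positive semidefinite square root of Y Yᵀ, and let P satisfy the four Penrose conditions with respect to R. Then R P Y = Y. -/
open Matrix

theorem stmt6 {n s : ℕ}
    (Y : Matrix (Fin n) (Fin s) ℝ) (R : Matrix (Fin n) (Fin n) ℝ)
    (hR : R.PosSemidef) (hR2 : R * R = Y * Yᵀ)
    (P : Matrix (Fin n) (Fin n) ℝ) (hP : IsPenrose R P) :
    R * P * Y = Y := by
  have hker : (R * P - 1) * (Y * Yᵀ) = 0 := by
    rw [← hR2, ← Matrix.mul_assoc, Matrix.sub_mul, hP.1, Matrix.one_mul, sub_self,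
      Matrix.zero_mul]
  rw [← conjTranspose_eq_transpose_of_trivial, mul_self_mul_conjTranspose_eq_zero,
    Matrix.sub_mul, Matrix.one_mul] at hker
  exact sub_eq_zero.mp hker
end

section
/- Let X ∈ ℝ^{m×s} and Y ∈ ℝ^{n×s}, let R be the positive semidefinite square root of Y Yᵀ, and let P satisfy the four Penrose conditions with respect to R. Then for every F ∈ ℝ^{m×n}: ‖X − F Y‖_F² = ‖X‖_F² − ‖X Yᵀ P‖_F² + ‖X Yᵀ P − F R‖_F². -/
open Matrix

theorem frob_sq {m n : Type*} [Fintype m] [Fintype n] (A : Matrix m n ℝ) :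
    frob A ^ 2 = (A * Aᵀ).trace := by
  have h : 0 ≤ ∑ i, ∑ j, A i j ^ 2 :=
    Finset.sum_nonneg fun i _ => Finset.sum_nonneg fun j _ => sq_nonneg _
  refine (Real.sq_sqrt h).trans ?_
  simp [Matrix.trace, Matrix.mul_apply, sq]

theorem frob_sub_sq {m n : Type*} [Fintype m] [Fintype n] (A B : Matrix m n ℝ) :
    frob (A - B) ^ 2 = frob A ^ 2 - 2 * (A * Bᵀ).trace + frob B ^ 2 := by
  have h : (B * Aᵀ).trace = (A * Bᵀ).trace := by
    rw [← Matrix.trace_transpose, Matrix.transpose_mul, Matrix.transpose_transpose]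
  simp only [frob_sq, Matrix.transpose_sub, Matrix.sub_mul, Matrix.mul_sub, Matrix.trace_sub, h]
  ring

/-- If `R * R = Y * Yᵀ` and `P` is an inner inverse of `R`, then `P * R` fixes the row space
of `Yᵀ`. -/
theorem transpose_mul_mul_eq_of_mul_self_eq {n s : Type*} [Fintype n] [Fintype s]
    {Y : Matrix n s ℝ} {R P : Matrix n n ℝ} (hR : R * R = Y * Yᵀ) (hP : R * P * R = R) :
    Yᵀ * (P * R) = Yᵀ := by
  classical
  have h : Y * Yᴴ * (P * R - 1) = 0 := by
    rw [Matrix.conjTranspose_eq_transpose_of_trivial, ← hR, Matrix.mul_sub, Matrix.mul_one,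
      Matrix.mul_assoc, ← Matrix.mul_assoc R P R, hP, sub_self]
  rw [Matrix.self_mul_conjTranspose_mul_eq_zero, Matrix.conjTranspose_eq_transpose_of_trivial,
    Matrix.mul_sub, Matrix.mul_one] at h
  exact sub_eq_zero.mp h

theorem stmt7 {m n s : ℕ}
    (X : Matrix (Fin m) (Fin s) ℝ) (Y : Matrix (Fin n) (Fin s) ℝ)
    (R : Matrix (Fin n) (Fin n) ℝ) (hR : R.PosSemidef) (hR2 : R * R = Y * Yᵀ)
    (P : Matrix (Fin n) (Fin n) ℝ) (hP : IsPenrose R P) :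
    ∀ F : Matrix (Fin m) (Fin n) ℝ,
      frob (X - F * Y) ^ 2 =
        frob X ^ 2 - frob (X * Yᵀ * P) ^ 2 + frob (X * Yᵀ * P - F * R) ^ 2 := by
  intro F
  have hRt : Rᵀ = R := by
    simpa only [Matrix.conjTranspose_eq_transpose_of_trivial] using hR.isHermitian.eq
  have hcross : X * Yᵀ * P * (F * R)ᵀ = X * (F * Y)ᵀ := by
    rw [Matrix.transpose_mul, Matrix.transpose_mul, hRt, ← Matrix.mul_assoc,
      Matrix.mul_assoc _ P R, Matrix.mul_assoc X, transpose_mul_mul_eq_of_mul_self_eq hR2 hP.1,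
      Matrix.mul_assoc]
  have hsq : frob (F * R) ^ 2 = frob (F * Y) ^ 2 := by
    rw [frob_sq, frob_sq, Matrix.transpose_mul, Matrix.transpose_mul, hRt, Matrix.mul_assoc,
      ← Matrix.mul_assoc R, hR2, Matrix.mul_assoc F, Matrix.mul_assoc Y]
  rw [frob_sub_sq, frob_sub_sq, hcross, hsq]
  ring
end

section
/- Let R ∈ ℝ^{n×n} be symmetric positive semidefinite, P satisfy the four Penrose conditions with respect to R, S ∈ ℝ^{m×n} satisfy S P R = S, and let M be a matrix of rank at most k minimizing ‖S − M‖_F over all matrices of rank at most k. Then M P R = M, i.e., every best rank-at-most-k Frobenius approximation of S has its row space contained in the column space of R. -/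
open Matrix

/-- Pythagoras for the Frobenius norm of matrices with orthogonal row spaces. -/
theorem frob_sub_sq_of_mul_transpose_eq_zero {m n : Type*} [Fintype m] [Fintype n]
    {A B : Matrix m n ℝ} (h : A * Bᵀ = 0) :
    frob (A - B) ^ 2 = frob A ^ 2 + frob B ^ 2 := by
  have h' : B * Aᵀ = 0 := by simpa using congrArg transpose h
  simp only [frob_sq, transpose_sub, Matrix.sub_mul, Matrix.mul_sub, h, h', trace_sub, trace_zero]
  ring

theorem eq_zero_of_frob_sq_eq_zero {m n : Type*} [Fintype m] [Fintype n]
    {A : Matrix m n ℝ} (h : frob A ^ 2 = 0) : A = 0 := by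
  rw [frob_sq, ← conjTranspose_eq_transpose_of_trivial] at h
  exact trace_mul_conjTranspose_self_eq_zero_iff.mp h

theorem stmt9 {m n k : ℕ}
    (R : Matrix (Fin n) (Fin n) ℝ) (hRsymm : Rᵀ = R) (hR : R.PosSemidef)
    (P : Matrix (Fin n) (Fin n) ℝ) (hP : IsPenrose R P)
    (S : Matrix (Fin m) (Fin n) ℝ) (hS : S * P * R = S)
    (M : Matrix (Fin m) (Fin n) ℝ) (hMrank : M.rank ≤ k)
    (hM : ∀ M' : Matrix (Fin m) (Fin n) ℝ, M'.rank ≤ k → frob (S - M) ≤ frob (S - M')) :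
    M * P * R = M := by
  obtain ⟨-, hPRP, -, hQsymm⟩ := hP
  rw [Matrix.mul_assoc] at hS ⊢
  have hQ : P * R * (P * R) = P * R := by rw [← Matrix.mul_assoc, hPRP]
  generalize P * R = Q at *
  have horth : (S - M * Q) * (M - M * Q)ᵀ = 0 := by
    have hSQ : S * (Q * Mᵀ) = S * Mᵀ := by rw [← Matrix.mul_assoc, hS]
    have hQQ : Q * (Q * Mᵀ) = Q * Mᵀ := by rw [← Matrix.mul_assoc, hQ]
    simp only [transpose_sub, transpose_mul, hQsymm, Matrix.sub_mul, Matrix.mul_sub,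
      Matrix.mul_assoc, hSQ, hQQ, sub_self]
  have hpyth := frob_sub_sq_of_mul_transpose_eq_zero horth
  rw [sub_sub_sub_cancel_right] at hpyth
  have hle : frob (S - M) ^ 2 ≤ frob (S - M * Q) ^ 2 :=
    pow_le_pow_left₀ (Real.sqrt_nonneg _) (hM _ ((rank_mul_le_left M Q).trans hMrank)) 2
  have hzero : frob (M - M * Q) ^ 2 = 0 :=
    le_antisymm (by linarith) (sq_nonneg _)
  exact (sub_eq_zero.mp (eq_zero_of_frob_sq_eq_zero hzero)).symm
end
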